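/- Assume T ≥ 2, that X is nonempty, and let (x^k)_{k≥1}, (y^k)_{k≥0} be alternate-projections sequences on X and Y (x^{k+1} is the unique nearest point of X to y^k, y^{k+1} the unique nearest point of Y to x^{k+1}, in the Euclidean norm). Then there exist x* ∈ X and y* ∈ Y with ‖x* − y*‖ = ⨅_{x ∈ X, y ∈ Y} ‖x − y‖, such that x^k → x*, y^k → y*, and for every k: ‖x^k − x*‖ ≤ 2·‖x^1 − x*‖·(1 − 4/(N·(T+1)²·(T−1)))^k, and ‖y^k − y*‖ ≤ 2·‖y^0 − y*‖·(1 − 4/(N·(T+1)²·(T−1)))^k. -/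

import Mathlib

open Relation in
lemma col_pos_bound {ι κ : Type*} [Fintype ι] [Fintype κ] (D : ι → κ → ℝ)
    (hrow : ∀ n, ∑ t, D n t = 0)
    (hac : ∀ t, ¬ TransGen (fun t s => ∃ n, D n t < 0 ∧ 0 < D n s) t t) (t : κ) :
    ∑ n, max (D n t) 0 ≤ ∑ s, max (∑ n, D n s) 0 := by
  classical
  set R : κ → κ → Prop := fun t s => ∃ n, D n t < 0 ∧ 0 < D n s with hR
  set S : Finset κ := Finset.univ.filter (fun s => ReflTransGen R t s) with hS
  have htS : t ∈ S := by simp [hS, ReflTransGen.refl]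
  have key : ∀ n, max (D n t) 0 ≤ ∑ s ∈ S, D n s := by
    intro n
    by_cases h : ∃ u ∈ S, D n u < 0
    · obtain ⟨u, huS, hu⟩ := h
      have hu' : ReflTransGen R t u := by simpa [hS] using huS
      have h1 : D n t ≤ 0 := by
        by_contra hc
        push Not at hc
        exact hac t (TransGen.tail' hu' ⟨n, hu, hc⟩)
      have h2 : ∑ s ∈ Sᶜ, D n s ≤ 0 := by
        apply Finset.sum_nonpos
        intro s hs
        by_contra hc
        push Not at hc
        have : s ∈ S := by
          simp only [hS, Finset.mem_filter, Finset.mem_univ, true_and]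
          exact hu'.tail ⟨n, hu, hc⟩
        exact (Finset.mem_compl.mp hs) this
      have h3 := Finset.sum_add_sum_compl S (fun s => D n s)
      rw [hrow] at h3
      rw [max_eq_right h1]
      linarith
    · push Not at h
      rw [max_eq_left (h t htS)]
      exact Finset.single_le_sum (f := fun s => D n s) h htS
  calc ∑ n, max (D n t) 0 ≤ ∑ n, ∑ s ∈ S, D n s := Finset.sum_le_sum fun n _ => key n
    _ = ∑ s ∈ S, ∑ n, D n s := Finset.sum_comm
    _ ≤ ∑ s ∈ S, max (∑ n, D n s) 0 := Finset.sum_le_sum fun s _ => le_max_left _ _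
    _ ≤ ∑ s, max (∑ n, D n s) 0 :=
      Finset.sum_le_sum_of_subset_of_nonneg (Finset.subset_univ _) fun _ _ _ => le_max_right _ _

open Relation in
lemma acyclic_bound {ι κ : Type*} [Fintype ι] [Fintype κ] (D : ι → κ → ℝ)
    (hrow : ∀ n, ∑ t, D n t = 0) (hcard : 2 ≤ Fintype.card κ)
    (hac : ∀ t, ¬ TransGen (fun t s => ∃ n, D n t < 0 ∧ 0 < D n s) t t) :
    ∑ t, ∑ n, D n t ^ 2 ≤
      (((Fintype.card κ : ℝ) - 2) * (Fintype.card κ : ℝ) / 2 + 1) * ∑ t, (∑ n, D n t) ^ 2 := by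
  classical
  set r : κ → ℝ := fun t => ∑ n, D n t with hr
  set F : ℝ := ∑ s, max (r s) 0 with hF
  have hrsum : ∑ t, r t = 0 := by
    rw [hr, Finset.sum_comm]; simp [hrow]
  have hF2 : ∑ s, max (-r s) 0 = F := by
    have : ∑ s, (max (r s) 0 - max (-r s) 0) = ∑ s, r s := by
      refine Finset.sum_congr rfl fun s _ => ?_
      rcases le_total (r s) 0 with h | h
      · rw [max_eq_right h, max_eq_left (by linarith)]; ring
      · rw [max_eq_left h, max_eq_right (by linarith)]; ring
    rw [Finset.sum_sub_distrib, hrsum] at this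
    linarith
  have habs : ∑ s, |r s| = 2 * F := by
    have : ∑ s, (max (r s) 0 + max (-r s) 0) = ∑ s, |r s| := by
      refine Finset.sum_congr rfl fun s _ => ?_
      rcases le_total (r s) 0 with h | h
      · rw [max_eq_right h, max_eq_left (by linarith), abs_of_nonpos h]; ring
      · rw [max_eq_left h, max_eq_right (by linarith), abs_of_nonneg h]; ring
    rw [Finset.sum_add_distrib, hF2] at this
    linarith
  have hin : ∀ t, ∑ n, max (D n t) 0 ≤ F := col_pos_bound D hrow hac
  have hout : ∀ t, ∑ n, max (-D n t) 0 ≤ F := by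
    intro t
    have h := col_pos_bound (fun n t => -D n t) (by intro n; simp [hrow]) (by
      intro t ht
      apply hac t
      refine TransGen.mono ?_ _ _ (TransGen.swap _ _ ht)
      rintro a b ⟨n, h1, h2⟩
      exact ⟨n, by linarith, by linarith⟩) t
    refine h.trans (le_of_eq ?_)
    rw [← hF2]
    refine Finset.sum_congr rfl fun s _ => ?_
    simp [hr]
  have hcol : ∀ t, ∑ n, D n t ^ 2 ≤ F ^ 2 + (F - |r t|) ^ 2 := by
    intro t
    set a := ∑ n, max (D n t) 0 with ha
    set b := ∑ n, max (-D n t) 0 with hb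
    have ha0 : 0 ≤ a := Finset.sum_nonneg fun _ _ => le_max_right _ _
    have hb0 : 0 ≤ b := Finset.sum_nonneg fun _ _ => le_max_right _ _
    have hab : a - b = r t := by
      rw [ha, hb, ← Finset.sum_sub_distrib]
      refine Finset.sum_congr rfl fun n _ => ?_
      rcases le_total (D n t) 0 with h | h
      · rw [max_eq_right h, max_eq_left (by linarith)]; ring
      · rw [max_eq_left h, max_eq_right (by linarith)]; ring
    have h1 : ∑ n, D n t ^ 2 = ∑ n, (max (D n t) 0) ^ 2 + ∑ n, (max (-D n t) 0) ^ 2 := by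
      rw [← Finset.sum_add_distrib]
      refine Finset.sum_congr rfl fun n _ => ?_
      rcases le_total (D n t) 0 with h | h
      · rw [max_eq_right h, max_eq_left (by linarith)]; ring
      · rw [max_eq_left h, max_eq_right (by linarith)]; ring
    have h2 : ∑ n, (max (D n t) 0) ^ 2 ≤ a ^ 2 :=
      Finset.sum_sq_le_sq_sum_of_nonneg fun _ _ => le_max_right _ _
    have h3 : ∑ n, (max (-D n t) 0) ^ 2 ≤ b ^ 2 :=
      Finset.sum_sq_le_sq_sum_of_nonneg fun _ _ => le_max_right _ _
    have h4 := hin t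
    have h5 := hout t
    have h6 : a ^ 2 + b ^ 2 ≤ F ^ 2 + (F - |r t|) ^ 2 := by
      rcases le_total (r t) 0 with h | h
      · rw [abs_of_nonpos h]
        have : a ≤ F - -r t := by linarith
        nlinarith
      · rw [abs_of_nonneg h]
        have : b ≤ F - r t := by linarith
        nlinarith
    linarith
  have hCS : (2 * F) ^ 2 ≤ (Fintype.card κ : ℝ) * ∑ t, r t ^ 2 := by
    rw [← habs]
    have := sq_sum_le_card_mul_sum_sq (s := (Finset.univ : Finset κ)) (f := fun t => |r t|)
    simpa using this
  have hc : (2 : ℝ) ≤ Fintype.card κ := by exact_mod_cast hcard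
  have htot : ∑ t, (F ^ 2 + (F - |r t|) ^ 2) =
      (Fintype.card κ : ℝ) * (2 * F ^ 2) - 2 * F * (2 * F) + ∑ t, r t ^ 2 := by
    have : ∀ t, F ^ 2 + (F - |r t|) ^ 2 = 2 * F ^ 2 - 2 * F * |r t| + r t ^ 2 := by
      intro t; nlinarith [sq_abs (r t)]
    simp_rw [this, Finset.sum_add_distrib, Finset.sum_sub_distrib, ← Finset.mul_sum, habs]
    simp
    ring
  have := Finset.sum_le_sum fun t (_ : t ∈ (Finset.univ : Finset κ)) => hcol t
  rw [htot] at this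
  refine this.trans ?_
  nlinarith

open Relation in
/-- a path gives a perturbation -/
lemma path_perturb {ι κ : Type*} [Fintype ι] [Fintype κ] [DecidableEq κ] (D : ι → κ → ℝ)
    {a b : κ} (h : TransGen (fun t s => ∃ n, D n t < 0 ∧ 0 < D n s) a b) :
    ∃ P : ι → κ → ℝ, (∀ n, ∑ t, P n t = 0) ∧
      (∀ t, ∑ n, P n t = (if t = a then 1 else 0) - (if t = b then 1 else 0)) ∧
      (∀ n t, 0 < P n t → D n t < 0) ∧ (∀ n t, P n t < 0 → 0 < D n t) ∧
      ∑ n, ∑ t, D n t * P n t < 0 := by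
  classical
  have single : ∀ a b : κ, (∃ n, D n a < 0 ∧ 0 < D n b) → 
    ∃ P : ι → κ → ℝ, (∀ n, ∑ t, P n t = 0) ∧
      (∀ t, ∑ n, P n t = (if t = a then 1 else 0) - (if t = b then 1 else 0)) ∧
      (∀ n t, 0 < P n t → D n t < 0) ∧ (∀ n t, P n t < 0 → 0 < D n t) ∧
      ∑ n, ∑ t, D n t * P n t < 0 := by
    rintro a b ⟨m, h1, h2⟩
    refine ⟨fun n t => if n = m then (if t = a then 1 else 0) - (if t = b then 1 else 0) else 0,
      ?_, ?_, ?_, ?_, ?_⟩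
    · intro n
      by_cases hn : n = m <;> simp [hn]
    · intro t; simp
    · intro n t h
      by_cases hn : n = m
      · subst hn
        by_cases hta : t = a
        · subst hta; exact h1
        · simp only [if_true, hta, if_false] at h
          split_ifs at h <;> norm_num at h
      · simp [hn] at h
    · intro n t h
      by_cases hn : n = m
      · subst hn
        by_cases htb : t = b
        · subst htb; exact h2
        · simp only [if_true, htb, if_false] at h
          split_ifs at h <;> norm_num at h
      · simp [hn] at h
    · rw [Finset.sum_eq_single m]
      · simp [mul_sub]; linarith
      · intro n _ hn; simp [hn]
      · simp
  induction h with
  | single h => exact single _ _ h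
  | tail _ h ih =>
    obtain ⟨P, p1, p2, p3, p4, p5⟩ := ih
    obtain ⟨Q, q1, q2, q3, q4, q5⟩ := single _ _ h
    refine ⟨fun n t => P n t + Q n t, ?_, ?_, ?_, ?_, ?_⟩
    · intro n; rw [Finset.sum_add_distrib, p1, q1, add_zero]
    · intro n; rw [Finset.sum_add_distrib, p2, q2]; ring
    · intro n t h
      by_cases hp : 0 < P n t
      · exact p3 n t hp
      · exact q3 n t (by linarith)
    · intro n t h
      by_cases hp : P n t < 0
      · exact p4 n t hp
      · exact q4 n t (by linarith)
    · simp_rw [mul_add, Finset.sum_add_distrib]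
      linarith

open Relation in
lemma error_bound (N T : ℕ) (hN : 1 ≤ N) (hT : 2 ≤ T)
    (E : Fin N → ℝ) (xlo xhi : Fin N → Fin T → ℝ) (q : Fin T → ℝ)
    (X S : Set (EuclideanSpace ℝ (Fin N × Fin T)))
    (hX : X = {a | (∀ n, ∑ t, a (n, t) = E n) ∧ ∀ n t, xlo n t ≤ a (n, t) ∧ a (n, t) ≤ xhi n t})
    (hS : S = {a | a ∈ X ∧ ∀ t, ∑ n, a (n, t) = q t}) (hSc : IsCompact S) (hSconv : Convex ℝ S)
    (hSne : S.Nonempty) (x z : EuclideanSpace ℝ (Fin N × Fin T)) (hx : x ∈ X)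
    (hz : ∀ t, ∑ n, z (n, t) = q t) :
    9 / ((N : ℝ) * ((T : ℝ) + 1) ^ 2 * ((T : ℝ) - 1)) * Metric.infDist x S ^ 2 ≤ ‖x - z‖ ^ 2 := by
  obtain ⟨w, hwS, hw⟩ := exists_norm_eq_iInf_of_complete_convex hSne hSc.isComplete hSconv x
  have hvar := (norm_eq_iInf_iff_real_inner_le_zero hSconv hwS).mp hw
  set D : Fin N → Fin T → ℝ := fun n t => w (n, t) - x (n, t) with hD
  have hwX : w ∈ X := by rw [hS] at hwS; exact hwS.1
  have hwq : ∀ t, ∑ n, w (n, t) = q t := by rw [hS] at hwS; exact hwS.2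
  have hwX' := hwX
  have hx' := hx
  rw [hX] at hwX' hx'
  have hrow : ∀ n, ∑ t, D n t = 0 := fun n => by
    simp only [hD, Finset.sum_sub_distrib]
    rw [hwX'.1, hx'.1, sub_self]
  have hac : ∀ t, ¬ TransGen (fun t s => ∃ n, D n t < 0 ∧ 0 < D n s) t t := by
    intro t ht
    obtain ⟨P, p1, p2, p3, p4, p5⟩ := path_perturb D ht
    have hev : ∀ᶠ ε : ℝ in nhdsWithin 0 (Set.Ioi 0), ∀ n, ∀ t, 
        (D n t < 0 → D n t + ε * P n t ≤ 0) ∧ (0 < D n t → 0 ≤ D n t + ε * P n t) := by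
      rw [Filter.eventually_all]; intro n
      rw [Filter.eventually_all]; intro t
      have hc : Filter.Tendsto (fun ε : ℝ => D n t + ε * P n t) (nhdsWithin 0 (Set.Ioi 0))
          (nhds (D n t)) := by
        have : Continuous (fun ε : ℝ => D n t + ε * P n t) := by fun_prop
        have h := this.tendsto 0
        simp only [zero_mul, add_zero] at h
        exact h.mono_left nhdsWithin_le_nhds
      rcases lt_trichotomy (D n t) 0 with h | h | h
      · filter_upwards [hc.eventually_lt_const h] with ε hε
        exact ⟨fun _ => hε.le, fun h' => absurd h' (by linarith)⟩
      · filter_upwards with ε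
        exact ⟨fun h' => absurd h' (by linarith), fun h' => absurd h' (by linarith)⟩
      · filter_upwards [hc.eventually_const_lt h] with ε hε
        exact ⟨fun h' => absurd h' (by linarith), fun _ => hε.le⟩
    obtain ⟨ε, hε, hε0⟩ := (hev.and self_mem_nhdsWithin).exists
    have hε0 : 0 < ε := hε0
    have hmem : w + ε • WithLp.toLp 2 (fun i : Fin N × Fin T => P i.1 i.2) ∈ S := by
      rw [hS]
      refine ⟨?_, ?_⟩
      · rw [hX]
        refine ⟨?_, ?_⟩
        · intro n
          simp [Finset.sum_add_distrib, ← Finset.mul_sum, p1, hwX'.1]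
        · intro n t
          have a := hwX'.2 n t
          have b := hx'.2 n t
          have c := hε n t
          simp only [hD] at c p3 p4
          simp only [PiLp.add_apply, PiLp.smul_apply, smul_eq_mul]
          rcases lt_trichotomy (P n t) 0 with h | h | h
          · have h1 := p4 n t h
            have h2 := c.2 h1
            have : ε * P n t < 0 := mul_neg_of_pos_of_neg hε0 h
            constructor <;> linarith
          · rw [h]; simpa using a
          · have h1 := p3 n t h
            have h2 := c.1 h1
            have : 0 < ε * P n t := mul_pos hε0 h
            constructor <;> linarith
      · intro t
        simp [Finset.sum_add_distrib, ← Finset.mul_sum, p2, hwq]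
    have h := hvar _ hmem
    rw [add_sub_cancel_left, inner_smul_right] at h
    have h2 : inner ℝ (x - w) (WithLp.toLp 2 (fun i : Fin N × Fin T => P i.1 i.2)) =
        - ∑ n, ∑ t, D n t * P n t := by
      rw [PiLp.inner_apply, Fintype.sum_prod_type, ← Finset.sum_neg_distrib]
      refine Finset.sum_congr rfl fun n _ => ?_
      rw [← Finset.sum_neg_distrib]
      refine Finset.sum_congr rfl fun t _ => ?_
      simp [hD]; ring
    rw [h2] at h
    nlinarith
  have hb := acyclic_bound D hrow (by simpa using hT) hac
  rw [Fintype.card_fin] at hb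
  have hinf : Metric.infDist x S ^ 2 ≤ ∑ t, ∑ n, D n t ^ 2 := by
    have h1 : Metric.infDist x S ≤ ‖x - w‖ := by
      rw [← dist_eq_norm]; exact Metric.infDist_le_dist_of_mem hwS
    have h2 : ‖x - w‖ ^ 2 = ∑ t, ∑ n, D n t ^ 2 := by
      rw [EuclideanSpace.norm_sq_eq, Fintype.sum_prod_type, Finset.sum_comm]
      refine Finset.sum_congr rfl fun n _ => Finset.sum_congr rfl fun t _ => ?_
      simp only [hD, PiLp.sub_apply, Real.norm_eq_abs, sq_abs]; ring
    rw [← h2]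
    exact pow_le_pow_left₀ Metric.infDist_nonneg h1 2
  have hzz : ∑ t, (∑ n, D n t) ^ 2 ≤ N * ‖x - z‖ ^ 2 := by
    rw [EuclideanSpace.norm_sq_eq, Fintype.sum_prod_type, Finset.sum_comm, Finset.mul_sum]
    refine Finset.sum_le_sum fun t _ => ?_
    have h1 : ∑ n, D n t = ∑ n, (z (n, t) - x (n, t)) := by
      simp only [hD, Finset.sum_sub_distrib, hwq, hz]
    rw [h1]
    have := sq_sum_le_card_mul_sum_sq (s := (Finset.univ : Finset (Fin N)))
      (f := fun n => z (n, t) - x (n, t))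
    rw [Finset.card_fin] at this
    refine this.trans (le_of_eq ?_)
    congr 1
    refine Finset.sum_congr rfl fun n _ => ?_
    simp only [PiLp.sub_apply, Real.norm_eq_abs, sq_abs]; ring
  have hN' : (1 : ℝ) ≤ N := by exact_mod_cast hN
  have hT' : (2 : ℝ) ≤ T := by exact_mod_cast hT
  set c : ℝ := ((T : ℝ) - 2) * T / 2 + 1 with hc
  have hc0 : 0 ≤ c := by
    have : 0 ≤ ((T : ℝ) - 2) * T := mul_nonneg (by linarith) (by linarith)
    rw [hc]; linarith
  have hcT : 9 * c ≤ ((T : ℝ) + 1) ^ 2 * ((T : ℝ) - 1) := by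
    have h1 : 0 ≤ ((T : ℝ) - 2) * (2 * (T : ℝ) ^ 2 - 3 * T + 10) :=
      mul_nonneg (by linarith) (by nlinarith)
    rw [hc]; nlinarith
  have hpos : 0 < (N : ℝ) * ((T : ℝ) + 1) ^ 2 * ((T : ℝ) - 1) := by
    have : 0 < (T : ℝ) - 1 := by linarith
    positivity
  rw [div_mul_eq_mul_div, div_le_iff₀ hpos]
  have h1 : Metric.infDist x S ^ 2 ≤ c * (N * ‖x - z‖ ^ 2) :=
    hinf.trans (hb.trans (mul_le_mul_of_nonneg_left hzz hc0))
  have h2 : 9 * c * (N * ‖x - z‖ ^ 2) ≤ ((T : ℝ) + 1) ^ 2 * ((T : ℝ) - 1) * (N * ‖x - z‖ ^ 2) :=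
    mul_le_mul_of_nonneg_right hcT (by positivity)
  nlinarith



open Filter Topology in
lemma apm_abstract {H : Type*} [NormedAddCommGroup H] (S : Set H) (hS : IsCompact S)
    (hne : S.Nonempty) (x z : ℕ → H) (μ ρ : ℝ) (hμ0 : 0 ≤ μ) (hρ0 : 0 ≤ ρ) (hρ1 : ρ < 1)
    (hρ2 : 1 ≤ 2 * ρ) (hρ3 : 1 - μ ≤ ρ ^ 2) (hρ4 : 1 - μ ≤ (1 + μ) * ρ ^ 4)
    (h1 : ∀ k, ∀ s ∈ S, ‖x (k + 1) - s‖ ^ 2 + ‖z k - x (k + 1)‖ ^ 2 ≤ ‖z k - s‖ ^ 2)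
    (h2 : ∀ k, ∀ s ∈ S, ‖z (k + 1) - s‖ ^ 2 + ‖x (k + 1) - z (k + 1)‖ ^ 2 ≤ ‖x (k + 1) - s‖ ^ 2)
    (h3 : ∀ k, μ * Metric.infDist (x (k + 1)) S ^ 2 ≤ ‖x (k + 1) - z (k + 1)‖ ^ 2)
    (h4 : ∀ k, μ * Metric.infDist (x (k + 2)) S ^ 2 ≤ ‖z (k + 1) - x (k + 2)‖ ^ 2) :
    ∃ s ∈ S, Tendsto x atTop (𝓝 s) ∧ Tendsto z atTop (𝓝 s) ∧
      (∀ k ≥ 1, ‖x k - s‖ ≤ 2 * ‖x 1 - s‖ * ρ ^ k) ∧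
      (∀ k, ‖z k - s‖ ≤ 2 * ‖z 0 - s‖ * ρ ^ k) := by
  have f1 : ∀ k, ∀ s ∈ S, ‖x (k + 1) - s‖ ≤ ‖z k - s‖ := fun k s hs => by
    have := h1 k s hs
    exact le_of_sq_le_sq (by nlinarith [sq_nonneg ‖z k - x (k + 1)‖]) (norm_nonneg _)
  have f2 : ∀ k, ∀ s ∈ S, ‖z (k + 1) - s‖ ≤ ‖x (k + 1) - s‖ := fun k s hs => by
    have := h2 k s hs
    exact le_of_sq_le_sq (by nlinarith [sq_nonneg ‖x (k + 1) - z (k + 1)‖]) (norm_nonneg _)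
  set d : ℕ → ℝ := fun k => Metric.infDist (x (k + 1)) S with hd
  set e : ℕ → ℝ := fun k => Metric.infDist (z k) S with he
  have hd0 : ∀ k, 0 ≤ d k := fun k => Metric.infDist_nonneg
  have he0 : ∀ k, 0 ≤ e k := fun k => Metric.infDist_nonneg
  have near : ∀ w : H, ∃ s ∈ S, Metric.infDist w S = ‖w - s‖ := fun w => by
    obtain ⟨s, hs, h⟩ := hS.exists_infDist_eq_dist hne w
    exact ⟨s, hs, by rw [h, dist_eq_norm]⟩
  have le : ∀ w : H, ∀ s ∈ S, Metric.infDist w S ≤ ‖w - s‖ := fun w s hs => by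
    rw [← dist_eq_norm]; exact Metric.infDist_le_dist_of_mem hs
  have r0 : d 0 ≤ e 0 := by
    obtain ⟨s, hs, h⟩ := near (z 0)
    exact (le _ s hs).trans ((f1 0 s hs).trans h.ge)
  have r1 : ∀ k, e (k + 1) ^ 2 ≤ (1 - μ) * d k ^ 2 := fun k => by
    obtain ⟨s, hs, h⟩ := near (x (k + 1))
    have a := h2 k s hs
    have b := h3 k
    have c : e (k + 1) ^ 2 ≤ ‖z (k + 1) - s‖ ^ 2 := pow_le_pow_left₀ (he0 _) (le _ s hs) 2
    rw [← h] at a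
    simp only [hd]
    linarith
  have r2 : ∀ k, (1 + μ) * d (k + 1) ^ 2 ≤ e (k + 1) ^ 2 := fun k => by
    obtain ⟨s, hs, h⟩ := near (z (k + 1))
    have a := h1 (k + 1) s hs
    have b := h4 k
    have c : d (k + 1) ^ 2 ≤ ‖x (k + 2) - s‖ ^ 2 := pow_le_pow_left₀ (hd0 _) (le _ s hs) 2
    rw [← h] at a
    change _ ≤ e (k + 1) ^ 2 at a
    change μ * d (k + 1) ^ 2 ≤ _ at b
    rw [show k + 1 + 1 = k + 2 from rfl] at a
    linarith
  have r3 : ∀ k, d (k + 1) ≤ ρ ^ 2 * d k := fun k => by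
    apply le_of_sq_le_sq _ (mul_nonneg (by positivity) (hd0 _))
    have a := r1 k
    have b := r2 k
    have c : (1 - μ) * d k ^ 2 ≤ ((1 + μ) * ρ ^ 4) * d k ^ 2 :=
      mul_le_mul_of_nonneg_right hρ4 (sq_nonneg _)
    have : (1 + μ) * d (k + 1) ^ 2 ≤ (1 + μ) * (ρ ^ 2 * d k) ^ 2 := by nlinarith
    exact le_of_mul_le_mul_left this (by linarith)
  have r4 : ∀ k, e (k + 1) ≤ ρ * d k := fun k => by
    apply le_of_sq_le_sq _ (mul_nonneg hρ0 (hd0 _))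
    have a := r1 k
    have c : (1 - μ) * d k ^ 2 ≤ ρ ^ 2 * d k ^ 2 :=
      mul_le_mul_of_nonneg_right hρ3 (sq_nonneg _)
    nlinarith
  have r5 : ∀ k, d k ≤ ρ ^ (2 * k) * d 0 := fun k => by
    induction k with
    | zero => simp
    | succ k ih =>
      calc d (k + 1) ≤ ρ ^ 2 * d k := r3 k
        _ ≤ ρ ^ 2 * (ρ ^ (2 * k) * d 0) := by gcongr
        _ = ρ ^ (2 * (k + 1)) * d 0 := by ring
  have r6 : ∀ k, e k ≤ ρ ^ k * e 0 := fun k => by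
    cases k with
    | zero => simp
    | succ k =>
      calc e (k + 1) ≤ ρ * d k := r4 k
        _ ≤ ρ * (ρ ^ (2 * k) * d 0) := by gcongr; exact r5 k
        _ ≤ ρ * (ρ ^ k * e 0) := by
          have : ρ ^ (2 * k) ≤ ρ ^ k := pow_le_pow_of_le_one hρ0 hρ1.le (by omega)
          have := hd0 0
          gcongr
        _ = _ := by ring
  -- monotonicity
  have mz : ∀ s ∈ S, Antitone fun k => ‖z k - s‖ := fun s hs =>
    antitone_nat_of_succ_le fun k => (f2 k s hs).trans (f1 k s hs)
  have mx : ∀ s ∈ S, Antitone fun k => ‖x (k + 1) - s‖ := fun s hs =>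
    antitone_nat_of_succ_le fun k => (f1 (k + 1) s hs).trans (f2 k s hs)
  have eto : Tendsto e atTop (𝓝 0) := by
    have : Tendsto (fun k => ρ ^ k * e 0) atTop (𝓝 (0 * e 0)) :=
      (tendsto_pow_atTop_nhds_zero_of_lt_one hρ0 hρ1).mul_const _
    rw [zero_mul] at this
    exact squeeze_zero he0 r6 this
  choose s hsS hs using fun k => near (z k)
  obtain ⟨xs, hxs, φ, hφ, hlim⟩ := hS.tendsto_subseq hsS
  have hz0 : Tendsto (fun k => ‖z k - xs‖) atTop (𝓝 0) := by
    refine (tendsto_iff_tendsto_subseq_of_antitone (mz xs hxs) hφ.tendsto_atTop).mpr ?_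
    have h : Tendsto (fun j => e (φ j) + ‖s (φ j) - xs‖) atTop (𝓝 (0 + 0)) :=
      (eto.comp hφ.tendsto_atTop).add (tendsto_iff_norm_sub_tendsto_zero.mp hlim)
    rw [add_zero] at h
    refine squeeze_zero (fun _ => norm_nonneg _) (fun j => ?_) h
    have h5 : e (φ j) = ‖z (φ j) - s (φ j)‖ := hs (φ j)
    rw [h5]
    exact norm_sub_le_norm_sub_add_norm_sub _ _ _
  have hz : Tendsto z atTop (𝓝 xs) := tendsto_iff_norm_sub_tendsto_zero.mpr hz0
  have hx1 : Tendsto (fun k => x (k + 1)) atTop (𝓝 xs) :=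
    tendsto_iff_norm_sub_tendsto_zero.mpr
      (squeeze_zero (fun _ => norm_nonneg _) (fun k => f1 k xs hxs) hz0)
  have hx : Tendsto x atTop (𝓝 xs) := (tendsto_add_atTop_iff_nat 1).mp hx1
  have bz : ∀ k, ‖z k - xs‖ ≤ 2 * e k := fun k => by
    have h5 : e k = ‖z k - s k‖ := hs k
    have h6 : ‖xs - s k‖ ≤ ‖z k - s k‖ :=
      le_of_tendsto (hz.sub_const (s k)).norm
        (eventually_atTop.mpr ⟨k, fun m hm => mz (s k) (hsS k) hm⟩)
    have h7 := norm_sub_le_norm_sub_add_norm_sub (z k) (s k) xs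
    rw [norm_sub_rev (s k) xs] at h7
    linarith
  have bx : ∀ k, ‖x (k + 1) - xs‖ ≤ 2 * d k := fun k => by
    obtain ⟨u, hu, h5⟩ := near (x (k + 1))
    change d k = _ at h5
    have h6 : ‖xs - u‖ ≤ ‖x (k + 1) - u‖ :=
      le_of_tendsto (hx1.sub_const u).norm
        (eventually_atTop.mpr ⟨k, fun m hm => mx u hu hm⟩)
    have h7 := norm_sub_le_norm_sub_add_norm_sub (x (k + 1)) u xs
    rw [norm_sub_rev u xs] at h7
    linarith
  refine ⟨xs, hxs, hx, hz, ?_, ?_⟩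
  · intro k hk
    obtain ⟨j, rfl⟩ : ∃ j, k = j + 1 := ⟨k - 1, by omega⟩
    rcases Nat.eq_zero_or_pos j with rfl | hj
    · have := norm_nonneg (x 1 - xs)
      simp only [zero_add, pow_one]
      nlinarith
    · have a : d 0 ≤ ‖x 1 - xs‖ := le _ xs hxs
      have b : ρ ^ (2 * j) ≤ ρ ^ (j + 1) := pow_le_pow_of_le_one hρ0 hρ1.le (by omega)
      calc _ ≤ 2 * d j := bx j
        _ ≤ 2 * (ρ ^ (2 * j) * d 0) := by gcongr; exact r5 j
        _ ≤ 2 * (ρ ^ (j + 1) * ‖x 1 - xs‖) := by have := hd0 0; gcongr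
        _ = _ := by ring
  · intro k
    have a : e 0 ≤ ‖z 0 - xs‖ := le _ xs hxs
    calc _ ≤ 2 * e k := bz k
      _ ≤ 2 * (ρ ^ k * e 0) := by gcongr; exact r6 k
      _ ≤ 2 * (ρ ^ k * ‖z 0 - xs‖) := by gcongr
      _ = _ := by ring

lemma inner_le_of_nearest {H : Type*} [NormedAddCommGroup H] [InnerProductSpace ℝ H] {K : Set H}
    (hK : Convex ℝ K) {u w : H} (hw : w ∈ K) (h : ∀ c ∈ K, ‖u - w‖ ≤ ‖u - c‖) :
    ∀ c ∈ K, inner ℝ (u - w) (c - w) ≤ 0 := by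
  apply (norm_eq_iInf_iff_real_inner_le_zero hK hw).mp
  have : Nonempty K := ⟨⟨w, hw⟩⟩
  refine le_antisymm (le_ciInf fun c => h c c.2) ?_
  exact ciInf_le (f := fun c : K => ‖u - c‖) ⟨0, by rintro _ ⟨c, rfl⟩; exact norm_nonneg _⟩ ⟨w, hw⟩

lemma pyth_le {H : Type*} [NormedAddCommGroup H] [InnerProductSpace ℝ H] (a b c : H)
    (h : 0 ≤ inner ℝ (a - b) (b - c)) : ‖b - c‖ ^ 2 + ‖a - b‖ ^ 2 ≤ ‖a - c‖ ^ 2 := by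
  have : a - c = (a - b) + (b - c) := by abel
  rw [this, norm_add_sq_real]
  linarith


/-- Explicit geometric convergence rate of the alternate projections method on the
transportation polytope `X` and the aggregation affine subspace `Y`. -/
theorem apm_rate_transportation
    (N T : ℕ) (hN : 1 ≤ N) (hT : 2 ≤ T)
    (E : Fin N → ℝ) (xlo xhi : Fin N → Fin T → ℝ) (p : Fin T → ℝ)
    (X Y : Set (EuclideanSpace ℝ (Fin N × Fin T)))
    (hX : X = {a | (∀ n, ∑ t, a (n, t) = E n) ∧ ∀ n t, xlo n t ≤ a (n, t) ∧ a (n, t) ≤ xhi n t})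
    (hY : Y = {b | ∀ t, ∑ n, b (n, t) = p t})
    (hXne : X.Nonempty)
    (x y : ℕ → EuclideanSpace ℝ (Fin N × Fin T))
    (hseqx : ∀ k, x (k + 1) ∈ X ∧ ∀ c ∈ X, ‖y k - x (k + 1)‖ ≤ ‖y k - c‖)
    (hseqy : ∀ k, y (k + 1) ∈ Y ∧ ∀ c ∈ Y, ‖x (k + 1) - y (k + 1)‖ ≤ ‖x (k + 1) - c‖) :
    ∃ xs ∈ X, ∃ ys ∈ Y,
      (∀ a ∈ X, ∀ b ∈ Y, ‖xs - ys‖ ≤ ‖a - b‖) ∧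
      Filter.Tendsto x Filter.atTop (nhds xs) ∧
      Filter.Tendsto y Filter.atTop (nhds ys) ∧
      (∀ k ≥ 1, ‖x k - xs‖ ≤
        2 * ‖x 1 - xs‖ * (1 - 4 / ((N : ℝ) * ((T : ℝ) + 1) ^ 2 * ((T : ℝ) - 1))) ^ k) ∧
      (∀ k, ‖y k - ys‖ ≤
        2 * ‖y 0 - ys‖ * (1 - 4 / ((N : ℝ) * ((T : ℝ) + 1) ^ 2 * ((T : ℝ) - 1))) ^ k) := by
  have hN' : (1 : ℝ) ≤ N := by exact_mod_cast hN
  have hT' : (2 : ℝ) ≤ T := by exact_mod_cast hT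
  -- the polytope is compact and convex
  have hXconv : Convex ℝ X := by
    rw [hX]
    rintro a ⟨a1, a2⟩ b ⟨b1, b2⟩ s t hs ht hst
    refine ⟨fun n => ?_, fun n τ => ?_⟩
    · simp only [PiLp.add_apply, PiLp.smul_apply, smul_eq_mul, Finset.sum_add_distrib,
        ← Finset.mul_sum, a1, b1]
      rw [← add_mul, hst, one_mul]
    · simp only [PiLp.add_apply, PiLp.smul_apply, smul_eq_mul]
      have hs' : s = 1 - t := by linarith
      have a3 := a2 n τ
      have b3 := b2 n τ
      constructor
      · have := mul_le_mul_of_nonneg_left a3.1 hs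
        have := mul_le_mul_of_nonneg_left b3.1 ht
        subst hs'
        linarith
      · have := mul_le_mul_of_nonneg_left a3.2 hs
        have := mul_le_mul_of_nonneg_left b3.2 ht
        subst hs'
        linarith
  have hYconv : Convex ℝ Y := by
    rw [hY]
    intro a a1 b b1 s t hs ht hst
    intro τ
    simp only [PiLp.add_apply, PiLp.smul_apply, smul_eq_mul, Finset.sum_add_distrib,
        ← Finset.mul_sum, a1 τ, b1 τ]
    rw [← add_mul, hst, one_mul]
  have hXclosed : IsClosed X := by
    have : X = (⋂ n, {a : EuclideanSpace ℝ (Fin N × Fin T) | ∑ t, a (n, t) = E n}) ∩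
        ⋂ n, ⋂ t, ({a : EuclideanSpace ℝ (Fin N × Fin T) | xlo n t ≤ a (n, t)} ∩
          {a : EuclideanSpace ℝ (Fin N × Fin T) | a (n, t) ≤ xhi n t}) := by
      rw [hX]; ext a; simp
    rw [this]
    refine IsClosed.inter (isClosed_iInter fun n => isClosed_eq (by fun_prop) (by fun_prop))
      (isClosed_iInter fun n => isClosed_iInter fun t => IsClosed.inter ?_ ?_)
    · exact isClosed_le (by fun_prop) (by fun_prop)
    · exact isClosed_le (by fun_prop) (by fun_prop)
  have hXc : IsCompact X := by
    have hK : IsCompact (Set.univ.pi fun i : Fin N × Fin T => Set.Icc (xlo i.1 i.2) (xhi i.1 i.2)) :=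
      isCompact_univ_pi fun _ => isCompact_Icc
    have hK2 := hK.image (PiLp.continuous_toLp 2 (fun _ : Fin N × Fin T => ℝ))
    refine hK2.of_isClosed_subset hXclosed ?_
    intro a ha
    rw [hX] at ha
    exact ⟨fun i => a i, fun i _ => ha.2 i.1 i.2, rfl⟩
  -- aggregation map
  let A : EuclideanSpace ℝ (Fin N × Fin T) →ₗ[ℝ] EuclideanSpace ℝ (Fin T) :=
    { toFun := fun a => WithLp.toLp 2 (fun t => ∑ n, a (n, t))
      map_add' := fun a b => by ext t; simp [Finset.sum_add_distrib]
      map_smul' := fun c a => by ext t; simp [Finset.mul_sum] }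
  have hA : ∀ a t, A a t = ∑ n, a (n, t) := fun a t => rfl
  have hAc : Continuous A := A.continuous_of_finiteDimensional
  have hKc : IsCompact (Set.image A X) := hXc.image hAc
  have hKconv : Convex ℝ (Set.image A X) := hXconv.linear_image A
  obtain ⟨q, hqK, hq⟩ := exists_norm_eq_iInf_of_complete_convex (hXne.image A) hKc.isComplete
    hKconv (WithLp.toLp 2 p)
  have hqvar := (norm_eq_iInf_iff_real_inner_le_zero hKconv hqK).mp hq
  obtain ⟨x0, hx0, hx0q⟩ := hqK
  set S : Set (EuclideanSpace ℝ (Fin N × Fin T)) := {a | a ∈ X ∧ ∀ t, ∑ n, a (n, t) = q t} with hS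
  have hSne : S.Nonempty := ⟨x0, hx0, fun t => by rw [← hx0q, hA]⟩
  have hSX : S ⊆ X := fun a ha => ha.1
  have hSA : S = X ∩ A ⁻¹' {q} := by
    ext a
    constructor
    · rintro ⟨h1, h2⟩
      exact ⟨h1, by ext t; exact h2 t⟩
    · rintro ⟨h1, h2⟩
      refine ⟨h1, fun t => ?_⟩
      have h2 : A a = q := h2
      rw [← h2, hA]
  have hSc : IsCompact S := by
    rw [hSA]; exact hXc.inter_right (isClosed_singleton.preimage hAc)
  have hSconv : Convex ℝ S := by
    rw [hSA]; exact hXconv.inter ((convex_singleton q).linear_preimage A)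
  set v : EuclideanSpace ℝ (Fin N × Fin T) :=
    WithLp.toLp 2 (fun i => (p i.2 - q i.2) / N) with hv
  have hNne : (N : ℝ) ≠ 0 := by linarith
  have hinv : ∀ a, inner ℝ v a = inner ℝ (WithLp.toLp 2 p - q) (A a) / N := fun a => by
    rw [PiLp.inner_apply, PiLp.inner_apply, Fintype.sum_prod_type, Finset.sum_comm, Finset.sum_div]
    refine Finset.sum_congr rfl fun t _ => ?_
    rw [hA]
    simp only [hv, PiLp.sub_apply, RCLike.inner_apply, conj_trivial]
    rw [Finset.sum_mul, Finset.sum_div]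
    refine Finset.sum_congr rfl fun n _ => ?_
    ring
  have hAS : ∀ s ∈ S, A s = q := fun s hs => by rw [hSA] at hs; exact hs.2
  have hvX : ∀ w ∈ X, ∀ s ∈ S, inner ℝ v (w - s) ≤ 0 := fun w hw s hs => by
    rw [hinv, map_sub, hAS s hs]
    exact div_nonpos_of_nonpos_of_nonneg (hqvar _ ⟨w, hw, rfl⟩) (by linarith)
  have hAY : ∀ b, b ∈ Y ↔ A b = WithLp.toLp 2 p := fun b => by
    rw [hY]
    constructor
    · intro h; ext t; exact h t
    · intro h t; rw [← hA, h]
  have hAv : A v = WithLp.toLp 2 p - q := by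
    ext t
    rw [hA]
    simp only [hv, Finset.sum_const, Finset.card_fin, nsmul_eq_mul, PiLp.sub_apply]
    field_simp
  have hvY : ∀ b ∈ Y, ∀ c ∈ Y, inner ℝ v (b - c) = 0 := fun b hb c hc => by
    rw [hinv, map_sub, (hAY b).mp hb, (hAY c).mp hc, sub_self, inner_zero_right, zero_div]
  have hSY : ∀ s ∈ S, s + v ∈ Y := fun s hs => by
    rw [hAY, map_add, hAS s hs, hAv]; abel
  have hYz : ∀ b ∈ Y, ∀ t, ∑ n, (b - v) (n, t) = q t := fun b hb t => by
    rw [← hA, map_sub, (hAY b).mp hb, hAv, sub_sub_cancel]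
  have hpos : 0 < (N : ℝ) * ((T : ℝ) + 1) ^ 2 * ((T : ℝ) - 1) := by
    have : 0 < (T : ℝ) - 1 := by linarith
    positivity
  have hge : 9 ≤ (N : ℝ) * ((T : ℝ) + 1) ^ 2 * ((T : ℝ) - 1) := by
    have h1 : 9 ≤ ((T : ℝ) + 1) ^ 2 := by nlinarith
    have h2 : 9 ≤ (N : ℝ) * ((T : ℝ) + 1) ^ 2 := by nlinarith
    nlinarith
  have herr := fun w z => error_bound N T hN hT E xlo xhi q X S hX hS hSc hSconv hSne w z
  have h9 : 9 / ((N : ℝ) * ((T : ℝ) + 1) ^ 2 * ((T : ℝ) - 1)) =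
      9 / 4 * (4 / ((N : ℝ) * ((T : ℝ) + 1) ^ 2 * ((T : ℝ) - 1))) := by ring
  rw [h9] at herr
  have ha0 : 0 < 4 / ((N : ℝ) * ((T : ℝ) + 1) ^ 2 * ((T : ℝ) - 1)) := by positivity
  have ha1 : 4 / ((N : ℝ) * ((T : ℝ) + 1) ^ 2 * ((T : ℝ) - 1)) ≤ 4 / 9 := by
    gcongr
  generalize 4 / ((N : ℝ) * ((T : ℝ) + 1) ^ 2 * ((T : ℝ) - 1)) = a at *
  obtain ⟨xs, hxs, t1, t2, b1, b2⟩ := apm_abstract S hSc hSne x (fun k => y k - v) (9 / 4 * a)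
    (1 - a) (by linarith) (by linarith) (by linarith) (by linarith) (by nlinarith)
    (by
      have : (1 + 9 / 4 * a) * (1 - a) ^ 4 - (1 - 9 / 4 * a) =
        a * (1 / 2 - 3 * a + (19 / 2) * a ^ 2 - 8 * a ^ 3 + 9 / 4 * a ^ 4) := by ring
      have h2 : 0 ≤ 1 / 2 - 3 * a + (19 / 2) * a ^ 2 - 8 * a ^ 3 + 9 / 4 * a ^ 4 := by
        nlinarith [sq_nonneg (a - 2 / 9), sq_nonneg (a ^ 2), mul_nonneg (sq_nonneg a) (sub_nonneg.mpr ha1)]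
      have := mul_nonneg ha0.le h2
      linarith)
    (by
      intro k s hs
      apply pyth_le
      have h1 := inner_le_of_nearest hXconv (hseqx k).1 (hseqx k).2 s (hSX hs)
      have h2 := hvX _ (hseqx k).1 s hs
      have h3 : inner ℝ (y k - v - x (k + 1)) (x (k + 1) - s) =
        - inner ℝ (y k - x (k + 1)) (s - x (k + 1)) - inner ℝ v (x (k + 1) - s) := by
        rw [← inner_neg_right, neg_sub, ← inner_sub_left]; congr 1; abel
      rw [h3]; linarith)
    (by
      intro k s hs
      apply pyth_le
      have h1 := inner_le_of_nearest hYconv (hseqy k).1 (hseqy k).2 _ (hSY s hs)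
      have h2 := hvY _ (hseqy k).1 _ (hSY s hs)
      have h3 : inner ℝ (x (k + 1) - (y (k + 1) - v)) (y (k + 1) - v - s) =
        - inner ℝ (x (k + 1) - y (k + 1)) (s + v - y (k + 1))
          + inner ℝ v (y (k + 1) - (s + v)) := by
        rw [← inner_neg_right, neg_sub, ← inner_add_left]; congr 1 <;> abel
      rw [h3]; linarith)
    (fun k => herr _ _ (hseqx k).1 (hYz _ (hseqy k).1))
    (fun k => by
      rw [norm_sub_rev]
      exact herr _ _ (hseqx (k + 1)).1 (hYz _ (hseqy k).1))
  have hsub : ∀ k, y k - (xs + v) = y k - v - xs := fun k => by abel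
  refine ⟨xs, hSX hxs, xs + v, hSY xs hxs, ?_, t1, ?_, b1, ?_⟩
  · intro a ha b hb
    have e1 : ‖xs - (xs + v)‖ = ‖v‖ := by rw [sub_add_cancel_left, norm_neg]
    rw [e1, norm_sub_rev]
    have h1 := hvX a ha xs hxs
    have h2 := hvY b hb _ (hSY xs hxs)
    have h3 : inner ℝ v (b - a) = inner ℝ v (b - (xs + v)) - inner ℝ v (a - xs) + ‖v‖ ^ 2 := by
      rw [← real_inner_self_eq_norm_sq, ← inner_sub_right, ← inner_add_right]; congr 1; abel
    have h4 := real_inner_le_norm v (b - a)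
    by_contra hc
    push Not at hc
    have := norm_nonneg (b - a)
    nlinarith
  · have := t2.add_const v
    simpa using this
  · intro k
    rw [hsub, hsub]
    exact b2 k
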